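/- Let m ≥ 3 and 1 ≤ i ≤ m−2. For every f ∈ F = ℚ(z_1,…,z_m) one has 𝒟_i(𝒟_{i+1}(𝒟_i f)) = (z_{i+2}²/z_i²)·∂_i(∂_{i+1}(∂_i(z_i²·z_{i+1}·f))) = (z_{i+2}²/z_i²)·[ f + (z_{i+1}+z_{i+2})·∂_i f + z_{i+2}·∂_{i+1} f + z_{i+1}z_{i+2}·∂_i(∂_{i+1} f) + z_{i+2}²·∂_{i+1}(∂_i f) + z_{i+1}z_{i+2}²·∂_i(∂_{i+1}(∂_i f)) ]. -/

import Mathlib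

noncomputable section

abbrev FQ (m : ℕ) := FractionRing (MvPolynomial (Fin m) ℚ)

noncomputable def z {m : ℕ} (a : Fin m) : FQ m :=
  algebraMap (MvPolynomial (Fin m) ℚ) (FQ m) (MvPolynomial.X a)

/-- The ℚ-algebra automorphism of `ℚ(z_1,…,z_m)` exchanging `z_a` and `z_b`. -/
noncomputable def swapHom {m : ℕ} (a b : Fin m) : FQ m →+* FQ m :=
  IsFractionRing.lift (g := (algebraMap (MvPolynomial (Fin m) ℚ) (FQ m)).comp
      (MvPolynomial.renameEquiv ℚ (Equiv.swap a b)).toRingEquiv.toRingHom)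
    ((IsFractionRing.injective (MvPolynomial (Fin m) ℚ) (FQ m)).comp
      (MvPolynomial.renameEquiv ℚ (Equiv.swap a b)).injective)

noncomputable def Dop {m : ℕ} (a b : Fin m) (f : FQ m) : FQ m :=
  z b / z a * ((z a * f - z b * swapHom a b f) / (z a - z b))

noncomputable def pDop {m : ℕ} (a b : Fin m) (f : FQ m) : FQ m :=
  (f - swapHom a b f) / (z a - z b)


theorem z_injective {m : ℕ} : Function.Injective (z : Fin m → FQ m) :=
  (IsFractionRing.injective (MvPolynomial (Fin m) ℚ) (FQ m)).comp MvPolynomial.X_injective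

theorem z_ne_zero {m : ℕ} (a : Fin m) : (z a : FQ m) ≠ 0 :=
  (map_ne_zero_iff _ (IsFractionRing.injective (MvPolynomial (Fin m) ℚ) (FQ m))).2
    (MvPolynomial.X_ne_zero a)

theorem swapHom_algebraMap {m : ℕ} (a b : Fin m) (p : MvPolynomial (Fin m) ℚ) :
    swapHom a b (algebraMap _ (FQ m) p) =
      algebraMap _ (FQ m) (MvPolynomial.rename (Equiv.swap a b) p) :=
  IsFractionRing.lift_algebraMap _ p

theorem swapHom_z {m : ℕ} (a b c : Fin m) : swapHom a b (z c) = z (Equiv.swap a b c) := by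
  rw [z, swapHom_algebraMap, MvPolynomial.rename_X, z]

theorem swapHom_swapHom {m : ℕ} (a b : Fin m) (f : FQ m) :
    swapHom a b (swapHom a b f) = f := by
  obtain ⟨p, q, -, rfl⟩ := IsFractionRing.div_surjective (A := MvPolynomial (Fin m) ℚ) f
  simp only [map_div₀, swapHom_algebraMap, MvPolynomial.rename_rename]
  have h : (Equiv.swap a b : Fin m → Fin m) ∘ Equiv.swap a b = id := by
    ext x
    simp
  simp only [h, MvPolynomial.rename_id_apply]

/-- The expansions of the braid word `𝒟 𝒟 𝒟` for any three distinct indices. -/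
theorem Dop_Dop_Dop {m : ℕ} {a b c : Fin m} (hab : a ≠ b) (hac : a ≠ c) (hbc : b ≠ c)
    (f : FQ m) :
    Dop a b (Dop b c (Dop a b f)) =
        z c ^ 2 / z a ^ 2 * pDop a b (pDop b c (pDop a b (z a ^ 2 * z b * f))) ∧
      Dop a b (Dop b c (Dop a b f)) =
        z c ^ 2 / z a ^ 2 *
          (f + (z b + z c) * pDop a b f + z c * pDop b c f +
            z b * z c * pDop a b (pDop b c f) +
            z c ^ 2 * pDop b c (pDop a b f) +
            z b * z c ^ 2 * pDop a b (pDop b c (pDop a b f))) := by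
  have h₁ : swapHom a b (z a) = z b := by simp [swapHom_z]
  have h₂ : swapHom a b (z b) = z a := by simp [swapHom_z]
  have h₃ : swapHom a b (z c) = z c := by
    rw [swapHom_z, Equiv.swap_apply_of_ne_of_ne hac.symm hbc.symm]
  have h₄ : swapHom b c (z b) = z c := by simp [swapHom_z]
  have h₅ : swapHom b c (z a) = z a := by
    rw [swapHom_z, Equiv.swap_apply_of_ne_of_ne hab hac]
  have ha := z_ne_zero a
  have hb := z_ne_zero b
  have hc := z_ne_zero c
  have kab : z a - z b ≠ 0 := sub_ne_zero.2 (z_injective.ne hab)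
  have kac : z a - z c ≠ 0 := sub_ne_zero.2 (z_injective.ne hac)
  have kbc : z b - z c ≠ 0 := sub_ne_zero.2 (z_injective.ne hbc)
  have kba : z b - z a = -(z a - z b) := by ring
  simp only [Dop, pDop, map_mul, map_div₀, map_sub, map_pow, h₁, h₂, h₃, h₄, h₅,
    swapHom_swapHom, kba]
  generalize swapHom a b (swapHom b c (swapHom a b f)) = f₁
  generalize swapHom a b (swapHom b c f) = f₂
  generalize swapHom b c (swapHom a b f) = f₃
  generalize swapHom a b f = f₄
  generalize swapHom b c f = f₅
  generalize z a = x at *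
  generalize z b = y at *
  generalize z c = w at *
  constructor
  · field_simp
    ring
  · field_simp
    ring

/-- expansion of `𝒟_i 𝒟_{i+1} 𝒟_i` in terms of the ordinary divided
difference operators `∂`. -/
theorem statement14 (m : ℕ) (hm : 3 ≤ m) (i : ℕ) (hi : i + 2 < m) (f : FQ m) :
    Dop ⟨i, by omega⟩ ⟨i + 1, by omega⟩
        (Dop ⟨i + 1, by omega⟩ ⟨i + 2, hi⟩
          (Dop ⟨i, by omega⟩ ⟨i + 1, by omega⟩ f))
        = z ⟨i + 2, hi⟩ ^ 2 / z ⟨i, by omega⟩ ^ 2 *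
            pDop ⟨i, by omega⟩ ⟨i + 1, by omega⟩
              (pDop ⟨i + 1, by omega⟩ ⟨i + 2, hi⟩
                (pDop ⟨i, by omega⟩ ⟨i + 1, by omega⟩
                  (z ⟨i, by omega⟩ ^ 2 * z ⟨i + 1, by omega⟩ * f))) ∧
      Dop ⟨i, by omega⟩ ⟨i + 1, by omega⟩
        (Dop ⟨i + 1, by omega⟩ ⟨i + 2, hi⟩
          (Dop ⟨i, by omega⟩ ⟨i + 1, by omega⟩ f))
        = z ⟨i + 2, hi⟩ ^ 2 / z ⟨i, by omega⟩ ^ 2 *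
            (f +
              (z ⟨i + 1, by omega⟩ + z ⟨i + 2, hi⟩) *
                pDop ⟨i, by omega⟩ ⟨i + 1, by omega⟩ f +
              z ⟨i + 2, hi⟩ * pDop ⟨i + 1, by omega⟩ ⟨i + 2, hi⟩ f +
              z ⟨i + 1, by omega⟩ * z ⟨i + 2, hi⟩ *
                pDop ⟨i, by omega⟩ ⟨i + 1, by omega⟩
                  (pDop ⟨i + 1, by omega⟩ ⟨i + 2, hi⟩ f) +
              z ⟨i + 2, hi⟩ ^ 2 *
                pDop ⟨i + 1, by omega⟩ ⟨i + 2, hi⟩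
                  (pDop ⟨i, by omega⟩ ⟨i + 1, by omega⟩ f) +
              z ⟨i + 1, by omega⟩ * z ⟨i + 2, hi⟩ ^ 2 *
                pDop ⟨i, by omega⟩ ⟨i + 1, by omega⟩
                  (pDop ⟨i + 1, by omega⟩ ⟨i + 2, hi⟩
                    (pDop ⟨i, by omega⟩ ⟨i + 1, by omega⟩ f))) := by
  exact Dop_Dop_Dop (by simp) (by simp) (by simp) f

end
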